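/- Fix c ∈ ℝ and let m = m(n) = ⌊n(log n + c)⌋. Then the probability that the digraph D(n,m) has at most one vertex of in-degree zero converges, as n → ∞, to (1 + e^{−c}) · e^{−e^{−c}}. -/

import Mathlib

open Filter

/-- The directed edges of the complete digraph on `Fin n`:
ordered pairs `(tail, head)` of distinct vertices. -/
abbrev DEdge (n : ℕ) := {e : Fin n × Fin n // e.1 ≠ e.2}

/-- `ε(n) = log log n / log n`. -/
noncomputable def eps (n : ℕ) : ℝ := Real.log (Real.log n) / Real.log n

/-- The number of available colours: `⌊(1 + 50 ε) n⌋`. -/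
noncomputable def numColours (n : ℕ) : ℕ := ⌊(1 + 50 * eps n) * n⌋₊

/-- The set of colours `W`. -/
abbrev Colour (n : ℕ) := Fin (numColours n)

/-- The sample space of the coloured random digraph process: a uniformly random
permutation of the edges (determining the random ordering `e₁, …, e_N`) together
with a uniformly random colouring of the edges. -/
abbrev SampleSpace (n : ℕ) := Equiv.Perm (DEdge n) × (DEdge n → Colour n)

/-- The (0-indexed) position of edge `e` in the random ordering determined by `ω`. -/
noncomputable def edgePos {n : ℕ} (ω : SampleSpace n) (e : DEdge n) : ℕ :=
  ((Fintype.equivFin (DEdge n)) (ω.1 e)).val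

/-- `e` is one of the first `m` edges of the process, i.e. an edge of `D(n,m)`. -/
def inProcess {n : ℕ} (ω : SampleSpace n) (m : ℕ) (e : DEdge n) : Prop :=
  edgePos ω e < m

/-- The probability of an event under the uniform measure on a finite sample space. -/
noncomputable def prob {Ω : Type*} [Fintype Ω] (p : Ω → Prop) : ℝ :=
  (Nat.card {ω : Ω // p ω} : ℝ) / (Fintype.card Ω : ℝ)

/-- Vertex `v` has in-degree zero in `D(n,m)`. -/
def InDegreeZero {n : ℕ} (ω : SampleSpace n) (m : ℕ) (v : Fin n) : Prop :=
  ∀ e : DEdge n, inProcess ω m e → e.val.2 ≠ v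

/-- The event `Z_m`: at most one vertex of `D(n,m)` has in-degree zero. -/
def ZEvent {n : ℕ} (ω : SampleSpace n) (m : ℕ) : Prop :=
  Set.Subsingleton {v : Fin n | InDegreeZero ω m v}

/-- `A` is the edge set of a spanning arborescence rooted at `u`: the root has no
in-edge, every other vertex has exactly one in-edge, and every vertex is reachable
from the root along edges of `A` (equivalently, for every vertex `v` there is
exactly one directed path from `u` to `v`). -/
def IsSpanningArborescence {n : ℕ} (A : Set (DEdge n)) (u : Fin n) : Prop :=
  (∀ e ∈ A, (e : DEdge n).val.2 ≠ u) ∧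
  (∀ v : Fin n, v ≠ u → ∃! e : DEdge n, e ∈ A ∧ e.val.2 = v) ∧
  (∀ v : Fin n, Relation.ReflTransGen (fun x y => ∃ e ∈ A, (e : DEdge n).val = (x, y)) u v)

/-- The event `A_m`: `D(n,m)` contains a spanning arborescence. -/
def AEvent {n : ℕ} (ω : SampleSpace n) (m : ℕ) : Prop :=
  ∃ (u : Fin n) (A : Set (DEdge n)), (∀ e ∈ A, inProcess ω m e) ∧ IsSpanningArborescence A u

/-- The event `R_m`: `D(n,m)` contains a rainbow spanning arborescence. -/
def REvent {n : ℕ} (ω : SampleSpace n) (m : ℕ) : Prop :=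
  ∃ (u : Fin n) (A : Set (DEdge n)), (∀ e ∈ A, inProcess ω m e) ∧
    IsSpanningArborescence A u ∧ Set.InjOn ω.2 A

/-- The hitting time `min {m : P m}`, with the convention `min ∅ = N = n(n-1)`. -/
noncomputable def hitTime (n : ℕ) (P : ℕ → Prop) : ℕ :=
  sInf ({m | P m} ∪ {n * (n - 1)})

open Finset in
/-- Permutations that send no element of `S` into `T`. -/
def avoidingPerms {α : Type*} [Fintype α] [DecidableEq α] (T S : Finset α) :
    Finset (Equiv.Perm α) :=
  {σ | ∀ e ∈ S, σ e ∉ T}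

section Avoiding

open Finset

variable {α : Type*} [Fintype α] [DecidableEq α]

lemma mem_avoidingPerms {T S : Finset α} {σ : Equiv.Perm α} :
    σ ∈ avoidingPerms T S ↔ ∀ e ∈ S, σ e ∉ T := by
  simp [avoidingPerms]

lemma card_avoidingPerms_insert_eq (T : Finset α) {S : Finset α} {a b : α}
    (ha : a ∉ S) (hb : b ∉ S) :
    #(avoidingPerms T (insert a S)) = #(avoidingPerms T (insert b S)) := by
  have key : ∀ x y : α, x ∉ S → y ∉ S → ∀ σ ∈ avoidingPerms T (insert x S),
      σ * Equiv.swap x y ∈ avoidingPerms T (insert y S) := by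
    intro x y hx hy σ hσ
    rw [mem_avoidingPerms] at hσ ⊢
    intro e he
    rcases mem_insert.1 he with rfl | he
    · simpa using hσ x (mem_insert_self _ _)
    · rw [Equiv.Perm.mul_apply, Equiv.swap_apply_of_ne_of_ne (ne_of_mem_of_not_mem he hx)
        (ne_of_mem_of_not_mem he hy)]
      exact hσ e (mem_insert_of_mem he)
  refine card_nbij' (· * Equiv.swap a b) (· * Equiv.swap b a) (key a b ha hb) (key b a hb ha) ?_ ?_
  · intro σ _
    simp [mul_assoc, Equiv.swap_comm b a]
  · intro σ _
    simp [mul_assoc, Equiv.swap_comm b a]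

lemma card_avoidingPerms_insert_mul (T : Finset α) {S : Finset α} {a : α} (ha : a ∉ S) :
    #(avoidingPerms T (insert a S)) * (Fintype.card α - #S) =
      #(avoidingPerms T S) * (Fintype.card α - #T - #S) := by
  have hfib : ∀ σ ∈ avoidingPerms T S, #{b ∈ Sᶜ | σ b ∉ T} = Fintype.card α - #T - #S := by
    intro σ hσ
    rw [mem_avoidingPerms] at hσ
    have himg : ({b ∈ Sᶜ | σ b ∉ T}).map σ.toEmbedding = Tᶜ \ S.map σ.toEmbedding := by
      ext x
      simp only [mem_map_equiv, mem_filter, mem_compl, Finset.mem_sdiff, Equiv.apply_symm_apply]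
      tauto
    have hsub : S.map σ.toEmbedding ⊆ Tᶜ := by
      intro x hx
      obtain ⟨e, he, rfl⟩ := mem_map.1 hx
      exact mem_compl.2 (hσ e he)
    rw [← card_map σ.toEmbedding, himg, card_sdiff_of_subset hsub, card_map, card_compl]
  calc #(avoidingPerms T (insert a S)) * (Fintype.card α - #S)
      = ∑ b ∈ Sᶜ, #(avoidingPerms T (insert b S)) := by
        rw [sum_congr rfl fun b hb =>
          card_avoidingPerms_insert_eq T (mem_compl.1 hb) ha, sum_const, card_compl,
          smul_eq_mul, mul_comm]
    _ = ∑ b ∈ Sᶜ, #{σ ∈ avoidingPerms T S | σ b ∉ T} := by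
        refine sum_congr rfl fun b _ => congrArg card ?_
        ext σ
        simp only [mem_filter, mem_avoidingPerms, forall_mem_insert]
        tauto
    _ = ∑ σ ∈ avoidingPerms T S, #{b ∈ Sᶜ | σ b ∉ T} :=
        sum_card_bipartiteAbove_eq_sum_card_bipartiteBelow fun b (σ : Equiv.Perm α) => σ b ∉ T
    _ = #(avoidingPerms T S) * (Fintype.card α - #T - #S) := by
        rw [sum_congr rfl hfib, sum_const, smul_eq_mul]

lemma card_avoidingPerms_mul (T S : Finset α) :
    #(avoidingPerms T S) * (Fintype.card α).descFactorial #S =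
      (Fintype.card α).factorial * (Fintype.card α - #T).descFactorial #S := by
  induction S using Finset.induction_on with
  | empty => simp [avoidingPerms, Fintype.card_perm]
  | insert a S ha ih =>
    rw [card_insert_of_notMem ha, Nat.descFactorial_succ, Nat.descFactorial_succ, ← mul_assoc,
      card_avoidingPerms_insert_mul T ha, mul_right_comm, ih]
    ring

end Avoiding

section InEdges

open Finset

/-- The edges whose head lies in `U`. -/
def inEdges {n : ℕ} (U : Finset (Fin n)) : Finset (DEdge n) := {e | e.val.2 ∈ U}

lemma card_inEdges {n : ℕ} (U : Finset (Fin n)) : #(inEdges U) = #U * (n - 1) := by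
  have hmaps : ∀ e ∈ inEdges U, (e : DEdge n).val.2 ∈ U := fun e he => by
    simpa [inEdges] using he
  rw [card_eq_sum_card_fiberwise hmaps]
  refine sum_const_nat fun v hv => ?_
  have : #((univ : Finset (Fin n)).erase v) = n - 1 := by simp
  rw [← this]
  refine card_bij (fun e _ => e.val.1) ?_ ?_ ?_
  · rintro ⟨⟨x, y⟩, h⟩ he
    simp only [mem_filter] at he
    simpa [← he.2] using h
  · rintro ⟨⟨x, y⟩, h⟩ he ⟨⟨x', y'⟩, h'⟩ he'
    simp_all
  · intro u hu
    exact ⟨⟨(u, v), by simpa using hu⟩, by simpa [inEdges] using hv, rfl⟩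

lemma card_dEdge (n : ℕ) : Fintype.card (DEdge n) = n * (n - 1) := by
  have h := card_inEdges (univ : Finset (Fin n))
  simpa [inEdges] using h

/-- The first `m` positions of the process, as a set of edges. -/
noncomputable def initialEdges (n m : ℕ) : Finset (DEdge n) :=
  {e | (Fintype.equivFin (DEdge n) e).val < m}

lemma card_initialEdges {n m : ℕ} (hm : m ≤ n * (n - 1)) : #(initialEdges n m) = m := by
  rw [← card_dEdge] at hm
  rw [← card_map (Fintype.equivFin (DEdge n)).toEmbedding]
  have : (initialEdges n m).map (Fintype.equivFin (DEdge n)).toEmbedding =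
      ({i | i.val < m} : Finset (Fin (Fintype.card (DEdge n)))) := by
    ext i
    simp [initialEdges, mem_map_equiv]
  rw [this, Fin.card_filter_val_lt, min_eq_right hm]

/-- The vertices none of whose in-edges are sent into `T`. -/
def sourceVertices {n : ℕ} (T : Finset (DEdge n)) (σ : Equiv.Perm (DEdge n)) : Finset (Fin n) :=
  {v | σ ∈ avoidingPerms T (inEdges {v})}

lemma subset_sourceVertices {n : ℕ} {T : Finset (DEdge n)} {σ : Equiv.Perm (DEdge n)}
    {U : Finset (Fin n)} : U ⊆ sourceVertices T σ ↔ σ ∈ avoidingPerms T (inEdges U) := by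
  simp only [subset_iff, sourceVertices, mem_filter, mem_univ, true_and, mem_avoidingPerms, inEdges,
    mem_singleton]
  exact ⟨fun h e he => h he e rfl, fun h v hv e he => h e (he ▸ hv)⟩

lemma zEvent_iff {n m : ℕ} (ω : SampleSpace n) :
    ZEvent ω m ↔ #(sourceVertices (initialEdges n m) ω.1) ≤ 1 := by
  rw [card_le_one_iff_subsingleton, ZEvent]
  have : {v : Fin n | InDegreeZero ω m v} = ↑(sourceVertices (initialEdges n m) ω.1) := by
    ext v
    simp only [Set.mem_ofPred_eq, InDegreeZero, inProcess, edgePos, sourceVertices, coe_filter,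
      mem_univ, true_and, mem_avoidingPerms, inEdges, mem_filter, mem_singleton, initialEdges]
    exact forall_congr' fun e => by tauto
  rw [this]

lemma sum_card_sourceVertices_choose {n : ℕ} (T : Finset (DEdge n)) (k : ℕ) :
    ∑ σ, (#(sourceVertices T σ)).choose k =
      ∑ U ∈ powersetCard k (univ : Finset (Fin n)), #(avoidingPerms T (inEdges U)) := by
  have h := sum_card_bipartiteAbove_eq_sum_card_bipartiteBelow
    (s := (univ : Finset (Equiv.Perm (DEdge n)))) (t := powersetCard k (univ : Finset (Fin n)))
    fun σ U => U ⊆ sourceVertices T σ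
  refine Eq.trans (sum_congr rfl fun σ _ => ?_) (h.trans (sum_congr rfl fun U _ => ?_))
  · rw [← card_powersetCard]
    congr 1
    ext U
    simp [bipartiteAbove, mem_powersetCard, and_comm]
  · congr 1
    ext σ
    simp [bipartiteBelow, subset_sourceVertices]

end InEdges

section InclusionExclusion

open Finset

lemma sum_range_neg_one_pow_mul_one_sub_mul_choose (x : ℕ) :
    ∑ k ∈ range (x + 1), (-1 : ℤ) ^ k * (1 - k) * x.choose k = if x ≤ 1 then 1 else 0 := by
  rcases x with _ | _ | x
  · simp
  · simp [sum_range_succ]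
  · have h₁ := Int.alternating_sum_range_choose_of_ne (Nat.succ_ne_zero (x + 1))
    have h₂ := Int.alternating_sum_range_choose_of_ne (Nat.succ_ne_zero x)
    have h₃ : ∑ k ∈ range (x + 1 + 1 + 1), (-1 : ℤ) ^ k * k * (x + 1 + 1).choose k =
        -(x + 1 + 1) * ∑ k ∈ range (x + 1 + 1), (-1 : ℤ) ^ k * (x + 1).choose k := by
      rw [sum_range_succ', mul_sum]
      simp only [Nat.cast_zero, mul_zero, zero_mul, add_zero]
      refine sum_congr rfl fun k _ => ?_
      have := Nat.add_one_mul_choose_eq (x + 1) k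
      have : ((x : ℤ) + 1 + 1) * (x + 1).choose k = (x + 1 + 1).choose (k + 1) * (k + 1) := by
        exact_mod_cast this
      push_cast
      rw [pow_succ]
      linear_combination (-(-1 : ℤ) ^ k) * (-this)
    simp only [Nat.succ_eq_add_one] at h₁ h₂
    rw [h₂, mul_zero] at h₃
    simp only [mul_sub, sub_mul, mul_one, sum_sub_distrib, h₁, h₃]
    simp

lemma sum_range_neg_one_pow_mul_one_sub_mul_choose_of_le {x n : ℕ} (h : x ≤ n) :
    ∑ k ∈ range (n + 1), (-1 : ℝ) ^ k * (1 - k) * x.choose k = if x ≤ 1 then 1 else 0 := by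
  rw [← sum_subset (range_mono (Nat.succ_le_succ h))]
  · exact_mod_cast congrArg (Int.cast : ℤ → ℝ) (sum_range_neg_one_pow_mul_one_sub_mul_choose x)
  · intro k _ hk
    rw [Nat.choose_eq_zero_of_lt (by simpa using hk)]
    simp

/-- The expected number of `k`-sets of vertices of in-degree zero in `D(n,m)`. -/
noncomputable def expectedSourceSets (n m k : ℕ) : ℝ :=
  n.choose k * ((n * (n - 1) - m).descFactorial (k * (n - 1)) /
    (n * (n - 1)).descFactorial (k * (n - 1)))

lemma sum_card_sourceVertices_choose_div {n m : ℕ} (hm : m ≤ n * (n - 1)) (k : ℕ) :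
    (∑ σ, ((#(sourceVertices (initialEdges n m) σ)).choose k : ℝ)) /
      (n * (n - 1)).factorial = expectedSourceSets n m k := by
  have hcard : ∀ U ∈ powersetCard k (univ : Finset (Fin n)),
      (#(avoidingPerms (initialEdges n m) (inEdges U)) : ℝ) = (n * (n - 1)).factorial *
        ((n * (n - 1) - m).descFactorial (k * (n - 1)) /
          (n * (n - 1)).descFactorial (k * (n - 1))) := by
    intro U hU
    have hU := (mem_powersetCard.1 hU).2
    have hk : k ≤ n := by simpa [hU] using card_le_univ U
    have h := card_avoidingPerms_mul (initialEdges n m) (inEdges U)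
    rw [card_inEdges, card_dEdge, card_initialEdges hm, hU] at h
    have hpos : ((n * (n - 1)).descFactorial (k * (n - 1)) : ℝ) ≠ 0 := by
      exact_mod_cast (Nat.descFactorial_pos.2 (Nat.mul_le_mul_right _ hk)).ne'
    rw [← mul_div_assoc, eq_div_iff hpos]
    exact_mod_cast h
  have h := congrArg (Nat.cast : ℕ → ℝ) (sum_card_sourceVertices_choose (initialEdges n m) k)
  push_cast at h
  rw [h, sum_congr rfl hcard, sum_const, card_powersetCard, card_univ, Fintype.card_fin,
    nsmul_eq_mul, expectedSourceSets]
  have : ((n * (n - 1)).factorial : ℝ) ≠ 0 := by positivity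
  field_simp

lemma prob_fst {α β : Type*} [Fintype α] [Fintype β] [Nonempty β] (p : α → Prop) :
    prob (fun ω : α × β => p ω.1) = prob p := by
  unfold prob
  rw [Nat.card_congr (Equiv.prodSubtypeFstEquivSubtypeProd (α := α) (β := β) (p := p)),
    Nat.card_prod, Fintype.card_prod, Nat.card_eq_fintype_card (α := β)]
  push_cast
  exact mul_div_mul_right _ _ (by exact_mod_cast Fintype.card_ne_zero)

lemma prob_zEvent_eq {n m : ℕ} (hm : m ≤ n * (n - 1)) (hc : 0 < numColours n) :
    prob (fun ω : SampleSpace n => ZEvent ω m) =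
      ∑' k : ℕ, (-1 : ℝ) ^ k * (1 - k) * expectedSourceSets n m k := by
  have : Nonempty (Colour n) := ⟨⟨0, hc⟩⟩
  simp only [zEvent_iff]
  rw [prob_fst (β := DEdge n → Colour n)
    fun σ : Equiv.Perm (DEdge n) => #(sourceVertices (initialEdges n m) σ) ≤ 1]
  rw [tsum_eq_sum (s := range (n + 1))]
  · simp only [← sum_card_sourceVertices_choose_div hm, ← mul_div_assoc, mul_sum]
    rw [← sum_div, sum_comm, prob, Fintype.card_perm, card_dEdge]
    congr 1
    rw [sum_congr rfl fun σ _ => sum_range_neg_one_pow_mul_one_sub_mul_choose_of_le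
      (by simpa using card_le_univ (sourceVertices (initialEdges n m) σ))]
    rw [Nat.card_eq_fintype_card, Fintype.card_subtype, sum_boole]
  · intro k hk
    rw [expectedSourceSets, Nat.choose_eq_zero_of_lt (by simpa using hk)]
    simp

end InclusionExclusion

section Bounds

lemma descFactorial_div_le_pow {M N K : ℕ} (hMN : M ≤ N) (hK : K ≤ N) :
    (M.descFactorial K : ℝ) / N.descFactorial K ≤ ((M : ℝ) / N) ^ K := by
  induction K with
  | zero => simp
  | succ j ih =>
    have hj : j < N := hK
    have hN : (0 : ℝ) < N := by exact_mod_cast (Nat.zero_le j).trans_lt hj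
    have hNj : (0 : ℝ) < (N - j : ℕ) := by exact_mod_cast Nat.sub_pos_of_lt hj
    rw [Nat.descFactorial_succ, Nat.descFactorial_succ, pow_succ']
    push_cast
    rw [mul_div_mul_comm]
    refine mul_le_mul ?_ (ih hj.le) (by positivity) (by positivity)
    rw [div_le_div_iff₀ hNj hN]
    rcases le_total M j with h | h
    · rw [Nat.sub_eq_zero_of_le h]
      simp only [Nat.cast_zero, zero_mul]
      positivity
    · rw [Nat.cast_sub h, Nat.cast_sub hj.le]
      have : (M : ℝ) ≤ N := by exact_mod_cast hMN
      nlinarith [(Nat.cast_nonneg j : (0 : ℝ) ≤ j)]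

lemma pow_le_descFactorial_div {M N K : ℕ} (hMN : M ≤ N) (hKM : K < M) :
    (((M : ℝ) - K) / (N - K)) ^ K ≤ (M.descFactorial K : ℝ) / N.descFactorial K := by
  have hMN' : (M : ℝ) ≤ N := by exact_mod_cast hMN
  have hKM' : (K : ℝ) < M := by exact_mod_cast hKM
  suffices ∀ j ≤ K, (((M : ℝ) - K) / (N - K)) ^ j ≤
      (M.descFactorial j : ℝ) / N.descFactorial j from this K le_rfl
  intro j
  induction j with
  | zero => simp
  | succ j ih =>
    intro hj
    have hj' : (j : ℝ) + 1 ≤ K := by exact_mod_cast hj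
    rw [Nat.descFactorial_succ, Nat.descFactorial_succ, pow_succ']
    push_cast
    rw [mul_div_mul_comm, Nat.cast_sub (by omega), Nat.cast_sub (by omega)]
    refine mul_le_mul ?_ (ih (by omega)) (pow_nonneg (div_nonneg ?_ ?_) _) (div_nonneg ?_ ?_)
    · rw [div_le_div_iff₀ (by linarith) (by linarith)]
      nlinarith [mul_nonneg (sub_nonneg.2 hMN') (show (0 : ℝ) ≤ K - j by linarith)]
    all_goals linarith

lemma expectedSourceSets_nonneg (n m k : ℕ) : 0 ≤ expectedSourceSets n m k := by
  unfold expectedSourceSets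
  positivity

lemma expectedSourceSets_le {n m k : ℕ} (hn : 2 ≤ n) (hm : m ≤ n * (n - 1)) :
    expectedSourceSets n m k ≤ (n * Real.exp (-(m / n))) ^ k / k.factorial := by
  rcases lt_or_ge n k with hk | hk
  · rw [expectedSourceSets, Nat.choose_eq_zero_of_lt hk]
    simp only [Nat.cast_zero, zero_mul]
    positivity
  have hn0 : (0 : ℝ) < n := by positivity
  have hn1 : (0 : ℝ) < (n - 1 : ℕ) := by exact_mod_cast Nat.sub_pos_of_lt hn
  have hratio := descFactorial_div_le_pow (Nat.sub_le (n * (n - 1)) m)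
    (Nat.mul_le_mul_right (n - 1) hk)
  have hbase : (((n * (n - 1) - m : ℕ) : ℝ) / (n * (n - 1) : ℕ)) ≤
      Real.exp (-(m / (n * (n - 1) : ℕ))) := by
    refine le_trans (le_of_eq ?_) (Real.one_sub_le_exp_neg _)
    rw [Nat.cast_sub hm]
    push_cast
    field_simp
  have hexp : Real.exp (-(m / (n * (n - 1) : ℕ))) ^ (k * (n - 1)) =
      Real.exp (-(m / n)) ^ k := by
    rw [← Real.exp_nat_mul, ← Real.exp_nat_mul]
    push_cast
    congr 1
    field_simp
  calc expectedSourceSets n m k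
      ≤ ((n : ℝ) ^ k / k.factorial) * Real.exp (-(m / n)) ^ k := by
        refine mul_le_mul (Nat.choose_le_pow_div k n) (hratio.trans ?_) (by positivity)
          (by positivity)
        rw [← hexp]
        exact pow_le_pow_left₀ (by positivity) hbase _
    _ = (n * Real.exp (-(m / n))) ^ k / k.factorial := by
        rw [mul_pow]
        ring

lemma le_expectedSourceSets {n m k : ℕ} (hn : 2 ≤ n) (h : k * (n - 1) + m < n * (n - 1)) :
    n.choose k * Real.exp (-(m / (n - k - m / (n - 1)))) ^ k ≤ expectedSourceSets n m k := by
  have hn1 : (0 : ℝ) < (n : ℝ) - 1 := by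
    have : (2 : ℝ) ≤ n := by exact_mod_cast hn
    linarith
  have hcast : ((n - 1 : ℕ) : ℝ) = n - 1 := by
    rw [Nat.cast_sub (by omega), Nat.cast_one]
  have hratio := pow_le_descFactorial_div (Nat.sub_le (n * (n - 1)) m)
    (show k * (n - 1) < n * (n - 1) - m by omega)
  have h' : (k : ℝ) * (n - 1) + m < n * (n - 1) := by
    rw [← hcast]
    exact_mod_cast h
  unfold expectedSourceSets
  refine mul_le_mul_of_nonneg_left (le_trans ?_ hratio) (Nat.cast_nonneg _)
  rw [Nat.cast_sub (by omega : m ≤ n * (n - 1))]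
  push_cast
  rw [hcast]
  set D : ℝ := n * (n - 1) - k * (n - 1) - m with hD
  have hDpos : 0 < D := by linarith
  have hbase : Real.exp (-(m / D)) ≤
      ((n : ℝ) * (n - 1) - m - k * (n - 1)) / (n * (n - 1) - k * (n - 1)) := by
    rw [Real.exp_neg, inv_le_comm₀ (Real.exp_pos _) (div_pos (by linarith) (by linarith)), inv_div]
    refine le_trans (le_of_eq ?_) (Real.add_one_le_exp (m / D))
    rw [show (n : ℝ) * (n - 1) - m - k * (n - 1) = D by ring,
      show (n : ℝ) * (n - 1) - k * (n - 1) = D + m by ring]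
    field_simp
    ring
  have hexp : Real.exp (-(m / (n - k - m / (n - 1)))) ^ k =
      Real.exp (-(m / D)) ^ (k * (n - 1)) := by
    rw [← Real.exp_nat_mul, ← Real.exp_nat_mul]
    push_cast
    rw [hcast]
    congr 1
    have : (n : ℝ) - k - m / (n - 1) = D / (n - 1) := by
      rw [hD]
      field_simp
    rw [this]
    field_simp
  rw [hexp]
  exact pow_le_pow_left₀ (Real.exp_pos _).le hbase _

end Bounds

section Limits

open Topology

/-- The number of edges `⌊n (log n + c)⌋` of the threshold digraph `D(n,m)`. -/
noncomputable def thresholdEdges (c : ℝ) (n : ℕ) : ℕ := ⌊(n : ℝ) * (Real.log n + c)⌋₊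

lemma tendsto_thresholdEdges_div_sub_log (c : ℝ) :
    Tendsto (fun n : ℕ => (thresholdEdges c n : ℝ) / n - Real.log n) atTop (𝓝 c) := by
  have hlog : ∀ᶠ n : ℕ in atTop, -c ≤ Real.log n :=
    (Real.tendsto_log_atTop.comp tendsto_natCast_atTop_atTop).eventually_ge_atTop _
  have hlow : Tendsto (fun n : ℕ => c - (n : ℝ)⁻¹) atTop (𝓝 c) := by
    simpa using tendsto_const_nhds.sub (tendsto_inv_atTop_nhds_zero_nat (𝕜 := ℝ))
  refine tendsto_of_tendsto_of_tendsto_of_le_of_le' hlow tendsto_const_nhds ?_ ?_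
  · filter_upwards [eventually_gt_atTop 0] with n hn
    have hn : (0 : ℝ) < n := by exact_mod_cast hn
    have := (Nat.lt_floor_add_one ((n : ℝ) * (Real.log n + c))).le
    rw [le_sub_iff_add_le, le_div_iff₀ hn, thresholdEdges]
    have hinv : (n : ℝ)⁻¹ * n = 1 := inv_mul_cancel₀ hn.ne'
    linarith
  · filter_upwards [eventually_gt_atTop 0, hlog] with n hn hl
    have hn : (0 : ℝ) < n := by exact_mod_cast hn
    have := Nat.floor_le (mul_nonneg hn.le (by linarith : 0 ≤ Real.log n + c))
    rw [sub_le_iff_le_add, div_le_iff₀ hn, thresholdEdges]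
    linarith

lemma tendsto_mul_exp_neg_thresholdEdges_div (c : ℝ) :
    Tendsto (fun n : ℕ => (n : ℝ) * Real.exp (-(thresholdEdges c n / n))) atTop
      (𝓝 (Real.exp (-c))) := by
  refine (Real.continuous_exp.tendsto _ |>.comp
    (tendsto_thresholdEdges_div_sub_log c).neg).congr' ?_
  filter_upwards [eventually_gt_atTop 0] with n hn
  have hn : (0 : ℝ) < n := by exact_mod_cast hn
  simp only [Function.comp_apply]
  rw [neg_sub, sub_eq_add_neg, Real.exp_add, Real.exp_log hn]

lemma tendsto_thresholdEdges_div_div_sqrt (c : ℝ) :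
    Tendsto (fun n : ℕ => (thresholdEdges c n : ℝ) / n / Real.sqrt n) atTop (𝓝 0) := by
  have hsqrt : Tendsto (fun n : ℕ => Real.sqrt n) atTop atTop :=
    Real.tendsto_sqrt_atTop.comp tendsto_natCast_atTop_atTop
  have hlog : Tendsto (fun n : ℕ => Real.log n / Real.sqrt n) atTop (𝓝 0) := by
    have := (isLittleO_log_rpow_atTop (r := 1 / 2) (by norm_num)).tendsto_div_nhds_zero
    simpa [Real.sqrt_eq_rpow, Function.comp_def] using this.comp tendsto_natCast_atTop_atTop
  have h := ((tendsto_thresholdEdges_div_sub_log c).div_atTop hsqrt).add hlog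
  rw [add_zero] at h
  refine h.congr fun n => ?_
  rw [← add_div, sub_add_cancel]

lemma tendsto_thresholdEdges_div_div (c : ℝ) :
    Tendsto (fun n : ℕ => (thresholdEdges c n : ℝ) / n / n) atTop (𝓝 0) := by
  have hsqrt : Tendsto (fun n : ℕ => Real.sqrt n) atTop atTop :=
    Real.tendsto_sqrt_atTop.comp tendsto_natCast_atTop_atTop
  refine ((tendsto_thresholdEdges_div_div_sqrt c).div_atTop hsqrt).congr fun n => ?_
  rw [div_div _ (Real.sqrt n), Real.mul_self_sqrt (Nat.cast_nonneg n)]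

lemma tendsto_natCast_div_sub_one : Tendsto (fun n : ℕ => (n : ℝ) / (n - 1)) atTop (𝓝 1) := by
  have h : Tendsto (fun n : ℕ => (1 - (n : ℝ)⁻¹)⁻¹) atTop (𝓝 1) := by
    simpa using (tendsto_const_nhds.sub (tendsto_inv_atTop_nhds_zero_nat (𝕜 := ℝ))).inv₀
      (show (1 : ℝ) - 0 ≠ 0 by norm_num)
  refine h.congr' ?_
  filter_upwards [eventually_gt_atTop 1] with n hn
  have hn : (1 : ℝ) < n := by exact_mod_cast hn
  have : (n : ℝ) - 1 ≠ 0 := by linarith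
  field_simp

lemma tendsto_relative_loss (c : ℝ) (k : ℕ) :
    Tendsto (fun n : ℕ => (k : ℝ) / n + (thresholdEdges c n : ℝ) / n / n * (n / (n - 1)))
      atTop (𝓝 0) := by
  simpa using (tendsto_const_div_atTop_nhds_zero_nat (k : ℝ)).add
    ((tendsto_thresholdEdges_div_div c).mul tendsto_natCast_div_sub_one)

lemma eventually_add_thresholdEdges_lt (c : ℝ) (k : ℕ) :
    ∀ᶠ n : ℕ in atTop, k * (n - 1) + thresholdEdges c n < n * (n - 1) := by
  filter_upwards [(tendsto_relative_loss c k).eventually_lt_const one_pos,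
    eventually_gt_atTop 1] with n h hn
  have hcast : ((n - 1 : ℕ) : ℝ) = n - 1 := by
    rw [Nat.cast_sub hn.le, Nat.cast_one]
  have hn' : (1 : ℝ) < n := by exact_mod_cast hn
  have hn1 : (0 : ℝ) < (n : ℝ) - 1 := by linarith
  have hprod := mul_lt_mul_of_pos_right h (show (0 : ℝ) < n * (n - 1) by positivity)
  have heq : ((k : ℝ) / n + (thresholdEdges c n : ℝ) / n / n * (n / (n - 1))) * (n * (n - 1)) =
      k * (n - 1) + thresholdEdges c n := by
    field_simp
  rw [heq, one_mul, ← hcast] at hprod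
  exact_mod_cast hprod

lemma tendsto_mul_exp_neg_thresholdEdges_div_sub (c : ℝ) (k : ℕ) :
    Tendsto (fun n : ℕ => (n : ℝ) *
      Real.exp (-(thresholdEdges c n / (n - k - thresholdEdges c n / (n - 1))))) atTop
      (𝓝 (Real.exp (-c))) := by
  have hloss := tendsto_relative_loss c k
  have hmul : Tendsto (fun n : ℕ => (thresholdEdges c n : ℝ) / n *
      ((k : ℝ) / n + (thresholdEdges c n : ℝ) / n / n * (n / (n - 1)))) atTop (𝓝 0) := by
    have h := ((tendsto_thresholdEdges_div_div c).const_mul (k : ℝ)).add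
      (((tendsto_thresholdEdges_div_div_sqrt c).pow 2).mul tendsto_natCast_div_sub_one)
    norm_num at h
    refine h.congr fun n => ?_
    rw [div_pow _ (Real.sqrt n), Real.sq_sqrt (Nat.cast_nonneg n)]
    ring
  have herr := hmul.div (tendsto_const_nhds.sub hloss) (show (1 : ℝ) - 0 ≠ 0 by norm_num)
  have h := (tendsto_mul_exp_neg_thresholdEdges_div c).mul
    (Real.continuous_exp.tendsto _ |>.comp herr.neg)
  rw [zero_div, neg_zero, Real.exp_zero, mul_one] at h
  refine h.congr' ?_
  filter_upwards [eventually_gt_atTop 1, hloss.eventually_lt_const one_pos] with n hn hlt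
  have hn' : (1 : ℝ) < n := by exact_mod_cast hn
  have hn1 : (n : ℝ) - 1 ≠ 0 := by linarith
  simp only [Function.comp_apply, Pi.div_apply]
  rw [mul_assoc, ← Real.exp_add]
  congr 2
  set d := (k : ℝ) / n + (thresholdEdges c n : ℝ) / n / n * (n / (n - 1)) with hd
  have hden : (n : ℝ) - k - thresholdEdges c n / (n - 1) = n * (1 - d) := by
    rw [hd]
    field_simp
    ring
  have hd1 : 1 - d ≠ 0 := by linarith
  rw [hden]
  field_simp
  ring

lemma tendsto_choose_div_pow (k : ℕ) :
    Tendsto (fun n : ℕ => (n.choose k : ℝ) / n ^ k) atTop (𝓝 (1 / k.factorial)) := by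
  have h := (isEquivalent_choose k).div
    (Asymptotics.IsEquivalent.refl (u := fun n : ℕ => (n : ℝ) ^ k))
  refine h.symm.tendsto_nhds ?_
  refine tendsto_const_nhds.congr' ?_
  filter_upwards [eventually_gt_atTop 0] with n hn
  have hn : (0 : ℝ) < n := by exact_mod_cast hn
  simp only [Pi.div_apply]
  field_simp

lemma tendsto_expectedSourceSets (c : ℝ) (k : ℕ) :
    Tendsto (fun n : ℕ => expectedSourceSets n (thresholdEdges c n) k) atTop
      (𝓝 (Real.exp (-c) ^ k / k.factorial)) := by
  have hupper := ((tendsto_mul_exp_neg_thresholdEdges_div c).pow k).div_const (k.factorial : ℝ)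
  have hlower := (tendsto_choose_div_pow k).mul
    ((tendsto_mul_exp_neg_thresholdEdges_div_sub c k).pow k)
  rw [one_div, mul_comm, ← div_eq_mul_inv] at hlower
  refine tendsto_of_tendsto_of_tendsto_of_le_of_le' hlower hupper ?_ ?_
  · filter_upwards [eventually_ge_atTop 2, eventually_add_thresholdEdges_lt c k] with n hn h
    refine le_trans (le_of_eq ?_) (le_expectedSourceSets hn h)
    have : (n : ℝ) ^ k ≠ 0 := by positivity
    rw [mul_pow]
    field_simp
  · filter_upwards [eventually_ge_atTop 2, eventually_add_thresholdEdges_lt c k] with n hn h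
    exact expectedSourceSets_le hn (by omega)

lemma hasSum_mul_pow_div_factorial (x : ℝ) :
    HasSum (fun k : ℕ => k * (x ^ k / k.factorial)) (x * Real.exp x) := by
  have h : HasSum (fun k : ℕ => x ^ k / k.factorial) (Real.exp x) := by
    rw [Real.exp_eq_exp_ℝ]
    exact NormedSpace.expSeries_div_hasSum_exp x
  rw [← hasSum_nat_add_iff' 1]
  simp only [Finset.range_one, Finset.sum_singleton, Nat.cast_zero, zero_mul, sub_zero]
  refine (h.mul_left x).congr_fun fun k => ?_
  rw [Nat.factorial_succ, pow_succ]
  push_cast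
  field_simp

lemma hasSum_one_sub_mul_pow_div_factorial (x : ℝ) :
    HasSum (fun k : ℕ => (1 - k) * (x ^ k / k.factorial)) ((1 - x) * Real.exp x) := by
  have h : HasSum (fun k : ℕ => x ^ k / k.factorial) (Real.exp x) := by
    rw [Real.exp_eq_exp_ℝ]
    exact NormedSpace.expSeries_div_hasSum_exp x
  simpa [sub_mul] using h.sub (hasSum_mul_pow_div_factorial x)

lemma eventually_numColours_pos : ∀ᶠ n : ℕ in atTop, 0 < numColours n := by
  have hlog : Tendsto (fun n : ℕ => Real.log n) atTop atTop :=
    Real.tendsto_log_atTop.comp tendsto_natCast_atTop_atTop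
  filter_upwards [hlog.eventually_ge_atTop 1, eventually_ge_atTop 1] with n hl hn
  have hn' : (1 : ℝ) ≤ n := by exact_mod_cast hn
  have heps : 0 ≤ eps n := div_nonneg (Real.log_nonneg hl) (by linarith)
  rw [numColours, Nat.floor_pos]
  nlinarith

lemma tendsto_tsum_expectedSourceSets (c : ℝ) :
    Tendsto (fun n : ℕ =>
        ∑' k : ℕ, (-1 : ℝ) ^ k * (1 - k) * expectedSourceSets n (thresholdEdges c n) k)
      atTop (𝓝 (∑' k : ℕ, (-1 : ℝ) ^ k * (1 - k) * (Real.exp (-c) ^ k / k.factorial))) := by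
  set B := Real.exp (-c) + 1
  have hB : 0 < B := by positivity
  refine tendsto_tsum_of_dominated_convergence
    (bound := fun k : ℕ => (1 + k) * (B ^ k / k.factorial)) ?_
    (fun k => (tendsto_expectedSourceSets c k).const_mul _) ?_
  · simpa only [add_mul, one_mul] using
      (Real.summable_pow_div_factorial B).add (hasSum_mul_pow_div_factorial B).summable
  · filter_upwards [(tendsto_mul_exp_neg_thresholdEdges_div c).eventually_le_const
      (lt_add_one _), eventually_ge_atTop 2, eventually_add_thresholdEdges_lt c 0] with n hle hn h k
    rw [norm_mul, norm_mul, norm_pow, norm_neg, norm_one, one_pow, one_mul,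
      Real.norm_of_nonneg (expectedSourceSets_nonneg _ _ _)]
    refine mul_le_mul ?_ ((expectedSourceSets_le hn (by omega)).trans ?_)
      (expectedSourceSets_nonneg _ _ _) (by positivity)
    · refine (norm_sub_le _ _).trans (by simp)
    · gcongr

end Limits

/-- For `m = ⌊n (log n + c)⌋`, the probability that `D(n,m)` has at
most one vertex of in-degree zero converges to `(1 + e^{-c}) e^{-e^{-c}}`. -/
theorem prob_at_most_one_indegree_zero_limit (c : ℝ) :
    Tendsto
      (fun n : ℕ => prob (fun ω : SampleSpace n =>
        ZEvent ω ⌊(n : ℝ) * (Real.log n + c)⌋₊))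
      atTop (nhds ((1 + Real.exp (-c)) * Real.exp (-Real.exp (-c)))) := by
  have h := tendsto_tsum_expectedSourceSets c
  have hsum : ∑' k : ℕ, (-1 : ℝ) ^ k * (1 - k) * (Real.exp (-c) ^ k / k.factorial) =
      (1 + Real.exp (-c)) * Real.exp (-Real.exp (-c)) := by
    rw [← sub_neg_eq_add, ← (hasSum_one_sub_mul_pow_div_factorial (-Real.exp (-c))).tsum_eq]
    refine tsum_congr fun k => ?_
    rw [neg_pow (Real.exp (-c))]
    ring
  rw [hsum] at h
  refine h.congr' ?_
  filter_upwards [eventually_numColours_pos, eventually_add_thresholdEdges_lt c 0] with n hc hm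
  exact (prob_zEvent_eq (by omega) hc).symm
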